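/- arXiv:2203.15049 — 4 statements merged into one kernel-verified Lean document; each statement's English description precedes it below -/
import Mathlib

section
/- Gyöngy–Krylov convergence criterion: Let X be a Polish space and (Y_N)_{N=1}^∞ a sequence of X-valued random variables on a probability space (Ω, ℬ, 𝒫). Then (Y_N) converges in probability (to some X-valued random variable) if and only if for every pair of subsequences (Y_{M_k}) and (Y_{N_k}), the sequence of joint laws of (Y_{M_k}, Y_{N_k}) on X × X has a further subsequence converging weakly to a Borel probability measure ν on X × X satisfying ν({(x, y) ∈ X × X : x = y}) = 1. -/
open MeasureTheory Filter Topology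
open scoped BoundedContinuousFunction ENNReal

/-- Existence of subsequences realising a property of pairs that holds for arbitrarily large
indices. -/
theorem exists_strictMono_pair_of_frequently {r : ℕ → ℕ → Prop}
    (h : ∀ K, ∃ m n, K ≤ m ∧ K ≤ n ∧ r m n) :
    ∃ φ ψ : ℕ → ℕ, StrictMono φ ∧ StrictMono ψ ∧ ∀ k, r (φ k) (ψ k) := by
  choose m n hm hn hr using h
  obtain ⟨α, hα, hmα⟩ := strictMono_subseq_of_tendsto_atTop (tendsto_atTop_mono hm tendsto_id)
  obtain ⟨β, hβ, hnβ⟩ := strictMono_subseq_of_tendsto_atTop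
    ((tendsto_atTop_mono hn tendsto_id).comp hα.tendsto_atTop)
  exact ⟨(m ∘ α) ∘ β, (n ∘ α) ∘ β, hmα.comp hβ, hnβ, fun k => hr _⟩

/-- Summability of truncated distances between consecutive terms forces the Cauchy property. -/
theorem cauchySeq_of_summable_min_one_dist {X : Type*} [PseudoMetricSpace X] {u : ℕ → X}
    (h : Summable fun k => min 1 (dist (u k) (u (k + 1)))) : CauchySeq u := by
  refine cauchySeq_of_summable_dist (h.congr_cofinite ?_)
  rw [Nat.cofinite_eq_atTop]
  filter_upwards [h.tendsto_atTop_zero.eventually (gt_mem_nhds one_pos)] with k hk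
  exact min_eq_right (by simpa using (min_lt_iff.1 hk).resolve_left (lt_irrefl _) |>.le)

/-- Nonnegative integrable functions with summable integrals are almost everywhere summable. -/
theorem ae_summable_of_summable_integral {Ω : Type*} [MeasurableSpace Ω] {P : Measure Ω}
    {g : ℕ → Ω → ℝ} (hg0 : ∀ k ω, 0 ≤ g k ω) (hgi : ∀ k, Integrable (g k) P)
    (hs : Summable fun k => ∫ ω, g k ω ∂P) :
    ∀ᵐ ω ∂P, Summable fun k => g k ω := by
  have hm : ∀ k, AEMeasurable (fun ω => ENNReal.ofReal (g k ω)) P :=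
    fun k => (hgi k).aemeasurable.ennreal_ofReal
  have hfin : ∫⁻ ω, ∑' k, ENNReal.ofReal (g k ω) ∂P ≠ ∞ := by
    rw [lintegral_tsum hm]
    simp_rw [← ofReal_integral_eq_lintegral_ofReal (hgi _) (ae_of_all _ (hg0 _))]
    exact hs.tsum_ofReal_ne_top
  filter_upwards [ae_lt_top' (AEMeasurable.tsum hm) hfin] with ω hω
  simpa only [ENNReal.toReal_ofReal (hg0 _ ω)] using ENNReal.summable_toReal hω.ne

section TruncatedDistance

variable {X : Type*} [MetricSpace X] [SecondCountableTopology X] [MeasurableSpace X] [BorelSpace X]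
  {Ω : Type*} [MeasurableSpace Ω] {P : Measure Ω} [IsProbabilityMeasure P]

theorem integrable_min_one_dist {f g : Ω → X} (hf : Measurable f) (hg : Measurable g) :
    Integrable (fun ω => min 1 (dist (f ω) (g ω))) P := by
  refine (integrable_const (1 : ℝ)).mono'
    (measurable_const.min (hf.dist hg)).aestronglyMeasurable (ae_of_all _ fun ω => ?_)
  rw [Real.norm_of_nonneg (le_min zero_le_one dist_nonneg)]
  exact min_le_left _ _

theorem tendsto_measure_dist_gt_of_tendsto_integral {Y : ℕ → Ω → X} {Z : Ω → X}
    (hY : ∀ N, Measurable (Y N)) (hZ : Measurable Z)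
    (h : Tendsto (fun N => ∫ ω, min 1 (dist (Y N ω) (Z ω)) ∂P) atTop (𝓝 0))
    {ε : ℝ} (hε : 0 < ε) :
    Tendsto (fun N => P {ω | ε < dist (Y N ω) (Z ω)}) atTop (𝓝 0) := by
  have hδ : 0 < min 1 ε := lt_min one_pos hε
  have hb : ∀ N, P {ω | ε < dist (Y N ω) (Z ω)} ≤
      ENNReal.ofReal ((∫ ω, min 1 (dist (Y N ω) (Z ω)) ∂P) / min 1 ε) := fun N => by
    have hM := mul_meas_ge_le_integral_of_nonneg (μ := P)
      (ae_of_all _ fun ω => le_min zero_le_one dist_nonneg)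
      (integrable_min_one_dist (hY N) hZ) (min 1 ε)
    calc P {ω | ε < dist (Y N ω) (Z ω)}
        ≤ P {ω | min 1 ε ≤ min 1 (dist (Y N ω) (Z ω))} :=
          measure_mono fun ω (hω : ε < _) => min_le_min le_rfl hω.le
      _ = ENNReal.ofReal (P.real {ω | min 1 ε ≤ min 1 (dist (Y N ω) (Z ω))}) := by
          simp
      _ ≤ _ := ENNReal.ofReal_le_ofReal ((le_div_iff₀' hδ).2 hM)
  refine tendsto_of_tendsto_of_tendsto_of_le_of_le tendsto_const_nhds ?_ (fun _ => zero_le) hb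
  simpa using ENNReal.tendsto_ofReal (h.div_const (min 1 ε))

/-- Completeness of the space of random variables under the expected truncated distance. -/
theorem exists_tendsto_integral_of_cauchy [CompleteSpace X] {Y : ℕ → Ω → X}
    (hY : ∀ N, Measurable (Y N))
    (h : ∀ ε : ℝ, 0 < ε → ∃ K, ∀ m n, K ≤ m → K ≤ n →
      ∫ ω, min 1 (dist (Y m ω) (Y n ω)) ∂P < ε) :
    ∃ Z : Ω → X, Measurable Z ∧
      Tendsto (fun N => ∫ ω, min 1 (dist (Y N ω) (Z ω)) ∂P) atTop (𝓝 0) := by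
  have : Nonempty X := (nonempty_of_isProbabilityMeasure P).map (Y 0)
  have hev : ∀ k : ℕ, ∀ᶠ K in atTop, ∀ m n, K ≤ m → K ≤ n →
      ∫ ω, min 1 (dist (Y m ω) (Y n ω)) ∂P < (1 / 2 : ℝ) ^ k := fun k => by
    obtain ⟨K, hK⟩ := h _ (pow_pos one_half_pos k)
    filter_upwards [eventually_ge_atTop K] with L hL m n hm hn
    exact hK m n (hL.trans hm) (hL.trans hn)
  obtain ⟨φ, hφ, hφK⟩ := extraction_forall_of_eventually hev
  have hsum : Summable fun k => ∫ ω, min 1 (dist (Y (φ k) ω) (Y (φ (k + 1)) ω)) ∂P :=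
    Summable.of_nonneg_of_le
      (fun k => integral_nonneg fun ω => le_min zero_le_one dist_nonneg)
      (fun k => (hφK k _ _ le_rfl (hφ.monotone k.le_succ)).le) summable_geometric_two
  have hlim : ∀ᵐ ω ∂P, ∃ l, Tendsto (fun k => Y (φ k) ω) atTop (𝓝 l) := by
    filter_upwards [ae_summable_of_summable_integral
      (fun k ω => le_min zero_le_one dist_nonneg)
      (fun k => integrable_min_one_dist (hY _) (hY _)) hsum] with ω hω
    exact cauchySeq_tendsto_of_complete (cauchySeq_of_summable_min_one_dist hω)
  obtain ⟨Z, hZ, hYZ⟩ := measurable_limit_of_tendsto_metrizable_ae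
    (fun k => (hY (φ k)).aemeasurable) hlim
  refine ⟨Z, hZ, Metric.tendsto_atTop.2 fun ε hε => ?_⟩
  obtain ⟨K, hK⟩ := h (ε / 2) (half_pos hε)
  refine ⟨K, fun N hN => ?_⟩
  have hDCT : Tendsto (fun k => ∫ ω, min 1 (dist (Y N ω) (Y (φ k) ω)) ∂P) atTop
      (𝓝 (∫ ω, min 1 (dist (Y N ω) (Z ω)) ∂P)) := by
    refine tendsto_integral_of_dominated_convergence (fun _ => (1 : ℝ))
      (fun k => (integrable_min_one_dist (hY _) (hY _)).aestronglyMeasurable)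
      (integrable_const _) (fun k => ae_of_all _ fun ω => ?_) ?_
    · rw [Real.norm_of_nonneg (le_min zero_le_one dist_nonneg)]
      exact min_le_left _ _
    · filter_upwards [hYZ] with ω hω
      exact tendsto_const_nhds.min (tendsto_const_nhds.dist hω)
  have hle : ∫ ω, min 1 (dist (Y N ω) (Z ω)) ∂P ≤ ε / 2 := by
    refine le_of_tendsto hDCT ?_
    filter_upwards [eventually_ge_atTop K] with k hk
    exact (hK N (φ k) hN (hk.trans (hφ.id_le k))).le
  rw [Real.dist_0_eq_abs, abs_of_nonneg (integral_nonneg fun ω => le_min zero_le_one dist_nonneg)]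
  linarith

end TruncatedDistance

/-- **Gyöngy–Krylov convergence criterion.** A sequence of random variables
`Y N` with values in a Polish space `X` converges in probability (to some
`X`-valued random variable) if and only if for every pair of subsequences
`(Y (φ k))`, `(Y (ψ k))` the sequence of joint laws on `X × X` admits a further
subsequence converging weakly to a Borel probability measure `ν` that is
concentrated on the diagonal, i.e. `ν {(x, y) | x = y} = 1`. -/
theorem gyongy_krylov
    {X : Type*} [MetricSpace X] [TopologicalSpace.SeparableSpace X] [CompleteSpace X]
    [MeasurableSpace X] [BorelSpace X]
    {Ω : Type*} [MeasurableSpace Ω] (P : Measure Ω) [IsProbabilityMeasure P]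
    (Y : ℕ → Ω → X) (hY : ∀ N, Measurable (Y N)) :
    (∃ Z : Ω → X, Measurable Z ∧
      ∀ ε : ℝ, 0 < ε →
        Tendsto (fun N => P {ω | ε < dist (Y N ω) (Z ω)}) atTop (𝓝 0))
    ↔
    (∀ φ ψ : ℕ → ℕ, StrictMono φ → StrictMono ψ →
      ∃ θ : ℕ → ℕ, StrictMono θ ∧
        ∃ ν : Measure (X × X), IsProbabilityMeasure ν ∧
          (∀ F : X × X →ᵇ ℝ,
            Tendsto
              (fun k => ∫ p, F p ∂(Measure.map (fun ω => (Y (φ (θ k)) ω, Y (ψ (θ k)) ω)) P))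
              atTop (𝓝 (∫ p, F p ∂ν))) ∧
          ν {p : X × X | p.1 = p.2} = 1) := by
  have : SecondCountableTopology X := UniformSpace.secondCountable_of_separable X
  constructor
  · rintro ⟨Z, hZ, hYZ⟩ φ ψ hφ hψ
    have hm : TendstoInMeasure P Y atTop Z := by
      rw [tendstoInMeasure_iff_dist]
      intro ε hε
      refine tendsto_of_tendsto_of_tendsto_of_le_of_le tendsto_const_nhds
        (hYZ (ε / 2) (half_pos hε)) (fun _ => zero_le) fun N => measure_mono fun ω hω => ?_
      exact (half_lt_self hε).trans_le hω
    obtain ⟨α, hα, hYα⟩ := (hm.comp hφ.tendsto_atTop).exists_seq_tendsto_ae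
    obtain ⟨β, hβ, hYβ⟩ :=
      (hm.comp (hψ.comp hα).tendsto_atTop).exists_seq_tendsto_ae
    refine ⟨α ∘ β, hα.comp hβ, P.map fun ω => (Z ω, Z ω),
      Measure.isProbabilityMeasure_map (hZ.prodMk hZ).aemeasurable, fun F => ?_, ?_⟩
    · have hmap : ∀ f g : Ω → X, Measurable f → Measurable g →
          ∫ p, F p ∂(P.map fun ω => (f ω, g ω)) = ∫ ω, F (f ω, g ω) ∂P := fun f g hf hg =>
        integral_map (hf.prodMk hg).aemeasurable F.continuous.aestronglyMeasurable
      simp only [hmap _ _ (hY _) (hY _), hmap _ _ hZ hZ]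
      refine tendsto_integral_of_dominated_convergence (fun _ => ‖F‖)
        (fun k => (F.continuous.measurable.comp
          ((hY _).prodMk (hY _))).aestronglyMeasurable)
        (integrable_const _) (fun k => ae_of_all _ fun ω => F.norm_coe_le_norm _) ?_
      filter_upwards [hYα, hYβ] with ω h₁ h₂
      exact (F.continuous.tendsto _).comp ((h₁.comp hβ.tendsto_atTop).prodMk_nhds h₂)
    · rw [Measure.map_apply (hZ.prodMk hZ) (measurableSet_eq_fun measurable_fst measurable_snd)]
      simp
  · intro h
    suffices hC : ∀ ε : ℝ, 0 < ε → ∃ K, ∀ m n, K ≤ m → K ≤ n →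
        ∫ ω, min 1 (dist (Y m ω) (Y n ω)) ∂P < ε by
      obtain ⟨Z, hZ, hYZ⟩ := exists_tendsto_integral_of_cauchy hY hC
      exact ⟨Z, hZ, fun ε hε => tendsto_measure_dist_gt_of_tendsto_integral hY hZ hYZ hε⟩
    intro ε hε
    by_contra! hne
    obtain ⟨φ, ψ, hφ, hψ, hr⟩ := exists_strictMono_pair_of_frequently hne
    obtain ⟨θ, -, ν, hν, hconv, hdiag⟩ := h φ ψ hφ hψ
    let F : X × X →ᵇ ℝ := BoundedContinuousFunction.ofNormedAddCommGroup
      (fun p => min 1 (dist p.1 p.2)) (by fun_prop) 1 fun p => by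
        rw [Real.norm_of_nonneg (le_min zero_le_one dist_nonneg)]
        exact min_le_left _ _
    have hzero : ∫ p, F p ∂ν = 0 := by
      refine integral_eq_zero_of_ae ?_
      have hae : ∀ᵐ p ∂ν, p ∈ {p : X × X | p.1 = p.2} :=
        (mem_ae_iff_prob_eq_one (measurableSet_eq_fun measurable_fst measurable_snd)).2 hdiag
      filter_upwards [hae] with p hp
      have hp' : p.1 = p.2 := hp
      simp [F, hp']
    have hlim := hconv F
    rw [hzero] at hlim
    refine hε.not_ge (ge_of_tendsto' hlim fun k => (hr (θ k)).trans_eq ?_)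
    exact (integral_map ((hY _).prodMk (hY _)).aemeasurable
      F.continuous.aestronglyMeasurable).symm
end

section
/- Existence of an r-barycenter in L^q: Let (S, Σ, μ) be a σ-finite measure space, 1 < q < ∞, d ≥ 1, and set X = L^q(S, μ; ℝ^d) with its usual norm. Let 1 ≤ r < ∞ and let Y be a strongly measurable X-valued random variable on a probability space (Ω, ℬ, 𝒫) with E[‖Y‖_X^r] < ∞. Then there exists Z* ∈ X attaining the minimum of the functional Z ↦ E[‖Y − Z‖_X^r] over Z ∈ X; that is, Y admits an r-barycenter E_r[Y]. -/
open MeasureTheory Filter Topology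
open scoped ENNReal NNReal

/-- In a complete uniformly convex space, a decreasing sequence of nonempty bounded closed convex
sets has a common point. -/
theorem nonempty_iInter_of_antitone_of_convex {X : Type*} [NormedAddCommGroup X] [NormedSpace ℝ X]
    [UniformConvexSpace X] [CompleteSpace X] {C : ℕ → Set X} (hanti : Antitone C)
    (hconv : ∀ n, Convex ℝ (C n)) (hclosed : ∀ n, IsClosed (C n)) (hne : ∀ n, (C n).Nonempty)
    (hbdd : Bornology.IsBounded (C 0)) : (⋂ n, C n).Nonempty := by
  set d : ℕ → ℝ := fun n => Metric.infDist 0 (C n)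
  have hmono : Monotone d := fun m n hmn =>
    Metric.infDist_le_infDist_of_subset (hanti hmn) (hne n)
  have hdle : ∀ n, ∀ x ∈ C n, d n ≤ ‖x‖ := fun n x hx => by
    simpa using Metric.infDist_le_dist_of_mem (x := (0 : X)) hx
  obtain ⟨M, hM⟩ := hbdd.exists_norm_le
  have hbound : BddAbove (Set.range d) := by
    refine ⟨M, ?_⟩
    rintro _ ⟨n, rfl⟩
    obtain ⟨x, hx⟩ := hne n
    exact (hdle n x hx).trans (hM x (hanti (Nat.zero_le n) hx))
  have htend : Tendsto d atTop (𝓝 (⨆ n, d n)) := tendsto_atTop_ciSup hmono hbound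
  set D := ⨆ n, d n
  have hdD : ∀ n, d n ≤ D := le_ciSup hbound
  have hD0 : 0 ≤ D := Metric.infDist_nonneg.trans (hdD 0)
  have hex : ∀ n : ℕ, ∃ z ∈ C n, ‖z‖ < d n + 1 / ((n : ℝ) + 1) := fun n => by
    have hlt : Metric.infDist 0 (C n) < d n + 1 / ((n : ℝ) + 1) :=
      lt_add_of_pos_right _ Nat.one_div_pos_of_nat
    obtain ⟨z, hz, hlt⟩ := (Metric.infDist_lt_iff (hne n)).1 hlt
    exact ⟨z, hz, by simpa using hlt⟩
  choose z hzC hz using hex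
  have hcauchy : CauchySeq z := by
    refine Metric.cauchySeq_iff'.2 fun ε hε => ?_
    obtain ⟨δ, hδ, hconvex⟩ :=
      exists_forall_closed_ball_dist_add_le_two_sub X (div_pos hε (by linarith : 0 < D + 1))
    have hlim : Tendsto (fun n : ℕ => 1 / ((n : ℝ) + 1) + (D - d n)) atTop (𝓝 (0 + (D - D))) :=
      tendsto_one_div_add_atTop_nhds_zero_nat.add (tendsto_const_nhds.sub htend)
    obtain ⟨N, hN⟩ := (hlim.eventually_lt_const
      (by simpa using by positivity : 0 + (D - D) < δ * ε / 4)).exists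
    refine ⟨N, fun n hn => ?_⟩
    by_contra! hdist
    rw [dist_eq_norm] at hdist
    set η : ℝ := 1 / ((N : ℝ) + 1) with hη
    have hη0 : 0 < η := Nat.one_div_pos_of_nat
    have hη1 : η ≤ 1 := by
      rw [hη, div_le_one (by positivity)]
      linarith [Nat.cast_nonneg (α := ℝ) N]
    have hr : 0 < D + η := by linarith
    have hzn : ‖z n‖ ≤ D + η := by
      have : 1 / ((n : ℝ) + 1) ≤ η := Nat.one_div_le_one_div hn
      linarith [hz n, hdD n]
    have hzN : ‖z N‖ ≤ D + η := by linarith [hz N, hdD N]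
    have hscale : ∀ x : X, ‖(D + η)⁻¹ • x‖ = ‖x‖ / (D + η) := fun x => by
      rw [norm_smul, norm_inv, Real.norm_of_nonneg hr.le, inv_mul_eq_div]
    have hsum := @hconvex ((D + η)⁻¹ • z n) (by rw [hscale]; exact (div_le_one hr).2 hzn)
      ((D + η)⁻¹ • z N) (by rw [hscale]; exact (div_le_one hr).2 hzN)
      (by rw [← smul_sub, hscale]; gcongr)
    rw [← smul_add, hscale, div_le_iff₀ hr] at hsum
    have hmid : (1 / 2 : ℝ) • z n + (1 / 2 : ℝ) • z N ∈ C N :=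
      hconv N (hanti hn (hzC n)) (hzC N) (by norm_num) (by norm_num) (by norm_num)
    have hlow := hdle N _ hmid
    rw [← smul_add, norm_smul, Real.norm_of_nonneg (by norm_num)] at hlow
    have hεr : ε ≤ 2 * (D + η) := by linarith [norm_sub_le (z n) (z N)]
    nlinarith [mul_le_mul_of_nonneg_left hεr hδ.le]
  obtain ⟨x, hx⟩ := cauchySeq_tendsto_of_complete hcauchy
  refine ⟨x, Set.mem_iInter.2 fun n => (hclosed n).mem_of_tendsto hx ?_⟩
  filter_upwards [eventually_ge_atTop n] with m hm using hanti hm (hzC m)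

/-- Every point has a nearest point in the range of a linear isometry defined on a complete
uniformly convex space. -/
theorem LinearIsometry.exists_norm_sub_le {X E : Type*} [NormedAddCommGroup X] [NormedSpace ℝ X]
    [UniformConvexSpace X] [CompleteSpace X] [NormedAddCommGroup E] [NormedSpace ℝ E]
    (T : X →ₗᵢ[ℝ] E) (y : E) : ∃ x, ∀ x', ‖y - T x‖ ≤ ‖y - T x'‖ := by
  set m := Metric.infDist y (Set.range T)
  have hne : (Set.range T).Nonempty := Set.range_nonempty T
  have key : (⋂ n : ℕ, T ⁻¹' Metric.closedBall y (m + 1 / ((n : ℝ) + 1))).Nonempty := by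
    refine nonempty_iInter_of_antitone_of_convex ?_ ?_ ?_ ?_ ?_
    · intro i j hij
      refine Set.preimage_mono (Metric.closedBall_subset_closedBall ?_)
      linarith [Nat.one_div_le_one_div (α := ℝ) hij]
    · exact fun n => (convex_closedBall y _).linear_preimage T.toLinearMap
    · exact fun n => Metric.isClosed_closedBall.preimage T.continuous
    · intro n
      have hlt : Metric.infDist y (Set.range T) < m + 1 / ((n : ℝ) + 1) :=
        lt_add_of_pos_right _ Nat.one_div_pos_of_nat
      obtain ⟨_, ⟨x, rfl⟩, hx⟩ := (Metric.infDist_lt_iff hne).1 hlt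
      exact ⟨x, by simpa [dist_comm] using hx.le⟩
    · exact T.antilipschitz.isBounded_preimage Metric.isBounded_closedBall
  obtain ⟨x, hx⟩ := key
  refine ⟨x, fun x' => ?_⟩
  have hle : ‖y - T x‖ ≤ m := by
    have hlim : Tendsto (fun n : ℕ => m + 1 / ((n : ℝ) + 1)) atTop (𝓝 (m + 0)) :=
      tendsto_const_nhds.add tendsto_one_div_add_atTop_nhds_zero_nat
    rw [add_zero] at hlim
    refine ge_of_tendsto' hlim fun n => ?_
    rw [← dist_eq_norm, dist_comm]
    exact Set.mem_iInter.1 hx n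
  rw [← dist_eq_norm y (T x')]
  exact hle.trans (Metric.infDist_le_dist_of_mem ⟨x', rfl⟩)

section Pointwise

variable {E : Type*} [NormedAddCommGroup E] [NormedSpace ℝ E]

theorem norm_half_add_rpow_le {p : ℝ} (hp : 1 ≤ p) (a b : E) :
    ‖(1 / 2 : ℝ) • (a + b)‖ ^ p ≤ (‖a‖ ^ p + ‖b‖ ^ p) / 2 := by
  have h1 : ‖(1 / 2 : ℝ) • (a + b)‖ ≤ (1 / 2 : ℝ) • ‖a‖ + (1 / 2 : ℝ) • ‖b‖ := by
    rw [norm_smul, Real.norm_of_nonneg (by norm_num), smul_eq_mul, smul_eq_mul]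
    linarith [norm_add_le a b]
  have h2 := (convexOn_rpow hp).2 (norm_nonneg a) (norm_nonneg b)
    (by norm_num : (0 : ℝ) ≤ 1 / 2) (by norm_num : (0 : ℝ) ≤ 1 / 2) (by norm_num)
  have h3 := Real.rpow_le_rpow (norm_nonneg _) h1 (zero_le_one.trans hp)
  simp only [smul_eq_mul] at h2 h3
  linarith

theorem norm_half_add_rpow_lt [StrictConvexSpace ℝ E] {p : ℝ} (hp : 1 < p) {a b : E}
    (hab : a ≠ b) : ‖(1 / 2 : ℝ) • (a + b)‖ ^ p < (‖a‖ ^ p + ‖b‖ ^ p) / 2 := by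
  have hp0 : 0 < p := by linarith
  rcases eq_or_ne ‖a‖ ‖b‖ with h | h
  · have hlt : ‖(1 / 2 : ℝ) • (a + b)‖ < ‖b‖ := by
      have := norm_combo_lt_of_ne h.le le_rfl hab (by norm_num : (0 : ℝ) < 1 / 2)
        (by norm_num : (0 : ℝ) < 1 / 2) (by norm_num)
      rwa [← smul_add] at this
    have := Real.rpow_lt_rpow (norm_nonneg _) hlt hp0
    rw [h]
    linarith
  · have h1 : ‖(1 / 2 : ℝ) • (a + b)‖ ≤ (1 / 2 : ℝ) • ‖a‖ + (1 / 2 : ℝ) • ‖b‖ := by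
      rw [norm_smul, Real.norm_of_nonneg (by norm_num), smul_eq_mul, smul_eq_mul]
      linarith [norm_add_le a b]
    have h2 := (strictConvexOn_rpow hp).2 (norm_nonneg a) (norm_nonneg b) h
      (by norm_num : (0 : ℝ) < 1 / 2) (by norm_num : (0 : ℝ) < 1 / 2) (by norm_num)
    have h3 := Real.rpow_le_rpow (norm_nonneg _) h1 hp0.le
    simp only [smul_eq_mul] at h2 h3
    linarith

/-- The normalized case of `exists_norm_sub_rpow_le`, by compactness. -/
theorem exists_norm_sub_rpow_le_of_add_eq_one [ProperSpace E] [StrictConvexSpace ℝ E] {p : ℝ}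
    (hp : 1 < p) {ε : ℝ} (hε : 0 < ε) :
    ∃ K, 0 < K ∧ ∀ a b : E, ‖a‖ ^ p + ‖b‖ ^ p = 1 →
      ‖a - b‖ ^ p ≤ ε + K * (1 / 2 - ‖(1 / 2 : ℝ) • (a + b)‖ ^ p) := by
  have hp0 : 0 < p := by linarith
  have hcont : Continuous fun x : E => ‖x‖ ^ p :=
    (Real.continuous_rpow_const hp0.le).comp continuous_norm
  have hcont_sum : Continuous fun x : E × E => ‖x.1‖ ^ p + ‖x.2‖ ^ p :=
    (hcont.comp continuous_fst).add (hcont.comp continuous_snd)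
  have hcont_sub : Continuous fun x : E × E => ‖x.1 - x.2‖ ^ p :=
    hcont.comp (continuous_fst.sub continuous_snd)
  have hcont_mid : Continuous fun x : E × E => ‖(1 / 2 : ℝ) • (x.1 + x.2)‖ ^ p :=
    hcont.comp ((continuous_fst.add continuous_snd).const_smul _)
  have hone : ∀ a b : E, ‖a‖ ^ p + ‖b‖ ^ p = 1 → ‖a‖ ≤ 1 ∧ ‖b‖ ≤ 1 := fun a b h => by
    have ha := Real.rpow_nonneg (norm_nonneg a) p
    have hb := Real.rpow_nonneg (norm_nonneg b) p
    constructor <;>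
    · refine (Real.rpow_le_rpow_iff (norm_nonneg _) zero_le_one hp0).1 ?_
      rw [Real.one_rpow]
      linarith
  have hcompact :
      IsCompact {x : E × E | ‖x.1‖ ^ p + ‖x.2‖ ^ p = 1 ∧ ε ≤ ‖x.1 - x.2‖ ^ p} := by
    refine (isCompact_closedBall (0 : E × E) 1).of_isClosed_subset ?_ ?_
    · exact (isClosed_eq hcont_sum continuous_const).inter
        (isClosed_le continuous_const hcont_sub)
    · rintro ⟨a, b⟩ ⟨h, -⟩
      simpa [Prod.norm_def] using hone a b h
  have hgap : ∀ x ∈ {x : E × E | ‖x.1‖ ^ p + ‖x.2‖ ^ p = 1 ∧ ε ≤ ‖x.1 - x.2‖ ^ p},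
      0 < (‖x.1‖ ^ p + ‖x.2‖ ^ p) / 2 - ‖(1 / 2 : ℝ) • (x.1 + x.2)‖ ^ p := by
    rintro x ⟨-, h⟩
    refine sub_pos.2 (norm_half_add_rpow_lt hp fun hab => ?_)
    rw [hab, sub_self, norm_zero, Real.zero_rpow hp0.ne'] at h
    linarith
  obtain ⟨κ, hκ, hκle⟩ := hcompact.exists_forall_le'
    ((hcont_sum.div_const 2).sub hcont_mid).continuousOn hgap
  refine ⟨2 ^ p / κ, by positivity, fun a b h => ?_⟩
  rcases le_total (‖a - b‖ ^ p) ε with h' | h'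
  · have := norm_half_add_rpow_le hp.le a b
    rw [h] at this
    have : 0 ≤ 2 ^ p / κ * (1 / 2 - ‖(1 / 2 : ℝ) • (a + b)‖ ^ p) :=
      mul_nonneg (by positivity) (by linarith)
    linarith
  · have h1 : κ ≤ (‖a‖ ^ p + ‖b‖ ^ p) / 2 - ‖(1 / 2 : ℝ) • (a + b)‖ ^ p :=
      hκle (a, b) ⟨h, h'⟩
    rw [h] at h1
    have h2 : ‖a - b‖ ^ p ≤ 2 ^ p :=
      Real.rpow_le_rpow (norm_nonneg _)
        (by linarith [norm_sub_le a b, (hone a b h).1, (hone a b h).2]) hp0.le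
    have h3 : (2 : ℝ) ^ p / κ * κ ≤
        2 ^ p / κ * (1 / 2 - ‖(1 / 2 : ℝ) • (a + b)‖ ^ p) := by gcongr
    rw [div_mul_cancel₀ _ hκ.ne'] at h3
    linarith

/-- In a strictly convex space with compact balls, `‖a - b‖ ^ p` is controlled, up to a small
multiple of `‖a‖ ^ p + ‖b‖ ^ p`, by the midpoint convexity gap of `‖·‖ ^ p`. -/
theorem exists_norm_sub_rpow_le [ProperSpace E] [StrictConvexSpace ℝ E] {p : ℝ} (hp : 1 < p)
    {ε : ℝ} (hε : 0 < ε) :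
    ∃ K, 0 < K ∧ ∀ a b : E, ‖a - b‖ ^ p ≤ ε * (‖a‖ ^ p + ‖b‖ ^ p) +
      K * ((‖a‖ ^ p + ‖b‖ ^ p) / 2 - ‖(1 / 2 : ℝ) • (a + b)‖ ^ p) := by
  have hp0 : 0 < p := by linarith
  obtain ⟨K, hK, hnormalized⟩ := exists_norm_sub_rpow_le_of_add_eq_one (E := E) hp hε
  refine ⟨K, hK, fun a b => ?_⟩
  have ha := Real.rpow_nonneg (norm_nonneg a) p
  have hb := Real.rpow_nonneg (norm_nonneg b) p
  have hnonneg := add_nonneg ha hb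
  set t := ‖a‖ ^ p + ‖b‖ ^ p with ht
  rcases hnonneg.eq_or_lt with h0 | hpos
  · have ha0 : a = 0 := by
      simpa using (Real.rpow_eq_zero (norm_nonneg a) hp0.ne').1 (by linarith)
    have hb0 : b = 0 := by
      simpa using (Real.rpow_eq_zero (norm_nonneg b) hp0.ne').1 (by linarith)
    simp [ht, ha0, hb0, Real.zero_rpow hp0.ne']
  · have hs : 0 < t ^ (-p⁻¹) := Real.rpow_pos_of_pos hpos _
    have hscale : ∀ x : E, ‖t ^ (-p⁻¹) • x‖ ^ p = t⁻¹ * ‖x‖ ^ p := fun x => by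
      rw [norm_smul, Real.norm_of_nonneg hs.le, Real.mul_rpow hs.le (norm_nonneg _),
        ← Real.rpow_mul hpos.le, neg_mul, inv_mul_cancel₀ hp0.ne', Real.rpow_neg_one]
    have h := hnormalized (t ^ (-p⁻¹) • a) (t ^ (-p⁻¹) • b) (by
      rw [hscale, hscale, ← mul_add]
      exact inv_mul_cancel₀ hpos.ne')
    rw [← smul_sub, ← smul_add, smul_comm, hscale, hscale] at h
    have h' := mul_le_mul_of_nonneg_left h hpos.le
    rw [mul_inv_cancel_left₀ hpos.ne'] at h'
    refine h'.trans_eq ?_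
    field_simp

end Pointwise

namespace MeasureTheory.Lp

variable {S : Type*} [MeasurableSpace S] {μ : Measure S} {q : ℝ≥0∞}
  {E : Type*} [NormedAddCommGroup E]

theorem integrable_norm_rpow (hq0 : q ≠ 0) (hq : q ≠ ∞) (f : Lp E q μ) :
    Integrable (fun s => ‖f s‖ ^ q.toReal) μ :=
  (Lp.memLp f).integrable_norm_rpow hq0 hq

theorem norm_rpow_eq_integral (hq0 : q ≠ 0) (hq : q ≠ ∞) (f : Lp E q μ) :
    ‖f‖ ^ q.toReal = ∫ s, ‖f s‖ ^ q.toReal ∂μ := by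
  have hnn : 0 ≤ ∫ s, ‖f s‖ ^ q.toReal ∂μ := integral_nonneg fun s => by positivity
  rw [Lp.norm_def, (Lp.memLp f).eLpNorm_eq_integral_rpow_norm hq0 hq,
    ENNReal.toReal_ofReal (by positivity),
    Real.rpow_inv_rpow hnn (ENNReal.toReal_pos hq0 hq).ne']

/-- `L^q` is uniformly convex for `1 < q < ∞`, for functions with values in a strictly convex
space with compact balls. -/
theorem uniformConvexSpace [NormedSpace ℝ E] [ProperSpace E] [StrictConvexSpace ℝ E]
    [Fact (1 ≤ q)] (hq1 : 1 < q) (hq : q ≠ ∞) : UniformConvexSpace (Lp E q μ) := by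
  have hq0 : q ≠ 0 := (zero_lt_one.trans hq1).ne'
  set p := q.toReal with hp
  have hp1 : 1 < p := by
    simpa using (ENNReal.toReal_lt_toReal ENNReal.one_ne_top hq).2 hq1
  have hp0 : 0 < p := by linarith
  refine ⟨fun ε hε => ?_⟩
  have hεp : 0 < ε ^ p := Real.rpow_pos_of_pos hε p
  obtain ⟨K, hK, hle⟩ :=
    exists_norm_sub_rpow_le (E := E) hp1 (by positivity : 0 < ε ^ p / 4)
  refine ⟨ε ^ p / (K * p), by positivity, fun x hx y hy hxy => ?_⟩
  have hint := fun f : Lp E q μ => integrable_norm_rpow hq0 hq f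
  have hmain : ‖x - y‖ ^ p ≤ ε ^ p / 4 * (‖x‖ ^ p + ‖y‖ ^ p) +
      K * ((‖x‖ ^ p + ‖y‖ ^ p) / 2 - ‖(1 / 2 : ℝ) • (x + y)‖ ^ p) := by
    have hsum : Integrable (fun s => ‖x s‖ ^ p + ‖y s‖ ^ p) μ := (hint x).add (hint y)
    have hgap : Integrable (fun s => (‖x s‖ ^ p + ‖y s‖ ^ p) / 2 -
        ‖((1 / 2 : ℝ) • (x + y) : Lp E q μ) s‖ ^ p) μ := (hsum.div_const 2).sub (hint _)
    simp only [hp, norm_rpow_eq_integral hq0 hq]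
    rw [← integral_add (hint x) (hint y), ← integral_const_mul, ← integral_div,
      ← integral_sub (hsum.div_const 2) (hint _), ← integral_const_mul,
      ← integral_add (hsum.const_mul _) (hgap.const_mul _)]
    refine integral_mono_ae (hint _) ((hsum.const_mul _).add (hgap.const_mul _)) ?_
    filter_upwards [Lp.coeFn_sub x y, Lp.coeFn_add x y, Lp.coeFn_smul (1 / 2 : ℝ) (x + y)]
      with s h1 h2 h3
    have := hle (x s) (y s)
    simpa only [h1, h2, h3, Pi.sub_apply, Pi.add_apply, Pi.smul_apply] using this
  have hnorm : ‖(1 / 2 : ℝ) • (x + y)‖ = ‖x + y‖ / 2 := by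
    rw [norm_smul, Real.norm_of_nonneg (by norm_num)]
    ring
  have hsub : ε ^ p ≤ ‖x - y‖ ^ p := Real.rpow_le_rpow hε.le hxy hp0.le
  have hbern := one_add_mul_self_le_rpow_one_add
    (by linarith [norm_nonneg (x + y)] : -1 ≤ ‖x + y‖ / 2 - 1) hp1.le
  rw [add_sub_cancel] at hbern
  rw [hx, hy, Real.one_rpow, hnorm] at hmain
  have h1 : K * (p * (‖x + y‖ / 2 - 1)) ≤ K * ((‖x + y‖ / 2) ^ p - 1) := by
    gcongr
    linarith
  rw [le_sub_iff_add_le, ← le_sub_iff_add_le', div_le_iff₀ (by positivity)]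
  nlinarith

end MeasureTheory.Lp

/-- **Existence of an `r`-barycenter in `L^q`.** Let `X = L^q(S, μ; ℝ^d)` with
`(S, μ)` σ-finite and `1 < q < ∞`, and let `Y` be a strongly measurable
`X`-valued random variable with `E ‖Y‖ ^ r < ∞` for some `1 ≤ r < ∞`. Then the
functional `Z ↦ E ‖Y - Z‖ ^ r` attains its minimum at some `Zstar ∈ X`,
i.e. `Y` admits an `r`-barycenter. -/
theorem exists_r_barycenter_Lq
    {S : Type*} [MeasurableSpace S] (μ : Measure S) [SigmaFinite μ]
    (q : ℝ≥0∞) [Fact (1 ≤ q)] (hq1 : 1 < q) (hq2 : q ≠ ∞)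
    (d : ℕ) (hd : 1 ≤ d)
    {Ω : Type*} [MeasurableSpace Ω] (P : Measure Ω) [IsProbabilityMeasure P]
    (r : ℝ) (hr : 1 ≤ r)
    (Y : Ω → Lp (EuclideanSpace ℝ (Fin d)) q μ) (hY : StronglyMeasurable Y)
    (hmom : ∫⁻ ω, (‖Y ω‖₊ : ℝ≥0∞) ^ r ∂P < ∞) :
    ∃ Zstar : Lp (EuclideanSpace ℝ (Fin d)) q μ,
      ∀ Z : Lp (EuclideanSpace ℝ (Fin d)) q μ,
        ∫⁻ ω, (‖Y ω - Zstar‖₊ : ℝ≥0∞) ^ r ∂P ≤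
          ∫⁻ ω, (‖Y ω - Z‖₊ : ℝ≥0∞) ^ r ∂P := by
  have := Lp.uniformConvexSpace (μ := μ) (E := EuclideanSpace ℝ (Fin d)) hq1 hq2
  have hr0 : 0 < r := by linarith
  have hp0 : ENNReal.ofReal r ≠ 0 := by simpa using hr0
  have hpr : (ENNReal.ofReal r).toReal = r := ENNReal.toReal_ofReal hr0.le
  have : Fact (1 ≤ ENNReal.ofReal r) := ⟨by simpa using hr⟩
  have heLp : ∀ f : Ω → Lp (EuclideanSpace ℝ (Fin d)) q μ,
      eLpNorm f (ENNReal.ofReal r) P = (∫⁻ ω, (‖f ω‖₊ : ℝ≥0∞) ^ r ∂P) ^ (1 / r) := fun f => by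
    rw [eLpNorm_eq_lintegral_rpow_enorm_toReal hp0 ENNReal.ofReal_ne_top, hpr]
    rfl
  have hYmem : MemLp Y (ENNReal.ofReal r) P := by
    refine ⟨hY.aestronglyMeasurable, ?_⟩
    rw [heLp]
    exact ENNReal.rpow_lt_top_of_nonneg (by positivity) hmom.ne
  let T : Lp (EuclideanSpace ℝ (Fin d)) q μ →ₗᵢ[ℝ]
      Lp (Lp (EuclideanSpace ℝ (Fin d)) q μ) (ENNReal.ofReal r) P :=
    { Lp.constₗ (ENNReal.ofReal r) P ℝ with
      norm_map' := fun Z => by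
        simpa using Lp.norm_const (ENNReal.ofReal r) P Z hp0 }
  have hmemZ : ∀ Z, MemLp (fun ω => Y ω - Z) (ENNReal.ofReal r) P := fun Z =>
    hYmem.sub (memLp_const Z)
  have hT : ∀ Z, ‖hYmem.toLp Y - T Z‖ = (eLpNorm (fun ω => Y ω - Z) (ENNReal.ofReal r) P).toReal :=
    fun Z => Lp.norm_toLp _ (hmemZ Z)
  obtain ⟨Zstar, hmin⟩ := T.exists_norm_sub_le (hYmem.toLp Y)
  refine ⟨Zstar, fun Z => ?_⟩
  have h := hmin Z
  rw [hT, hT, ENNReal.toReal_le_toReal (hmemZ _).eLpNorm_ne_top (hmemZ _).eLpNorm_ne_top,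
    heLp, heLp] at h
  exact (ENNReal.rpow_le_rpow_iff (by positivity)).1 h
end

section
/- Uniqueness of the r-barycenter in L^q: Let (S, Σ, μ) be a σ-finite measure space, 1 < q < ∞, d ≥ 1, X = L^q(S, μ; ℝ^d), and 1 < r < ∞. Let Y be a strongly measurable X-valued random variable with E[‖Y‖_X^r] < ∞. If b₁, b₂ ∈ X both minimize the functional Z ↦ E[‖Y − Z‖_X^r] over X, then b₁ = b₂; i.e. the r-barycenter E_r[Y] is unique. -/
open MeasureTheory Filter Topology
open scoped ENNReal NNReal

/-- In a strictly convex space, `x ↦ ‖x‖ ^ p` with `1 < p` is strictly midpoint convex. -/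
theorem enorm_midpoint_rpow_lt {E : Type*} [NormedAddCommGroup E] [NormedSpace ℝ E]
    [StrictConvexSpace ℝ E] {p : ℝ} (hp : 1 < p) {x y : E} (hxy : x ≠ y) :
    ‖(2⁻¹ : ℝ) • (x + y)‖ₑ ^ p < 2⁻¹ * (‖x‖ₑ ^ p + ‖y‖ₑ ^ p) := by
  have hp0 : 0 ≤ p := by linarith
  have key : ‖(2⁻¹ : ℝ) • (x + y)‖ ^ p < 2⁻¹ * (‖x‖ ^ p + ‖y‖ ^ p) := by
    have hconv := strictConvexOn_rpow hp
    rw [smul_add]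
    rcases eq_or_ne ‖x‖ ‖y‖ with h | h
    · have hlt : ‖(2⁻¹ : ℝ) • x + (2⁻¹ : ℝ) • y‖ < ‖y‖ :=
        norm_combo_lt_of_ne h.le le_rfl hxy (by norm_num) (by norm_num) (by norm_num)
      have := Real.rpow_lt_rpow (norm_nonneg _) hlt (by linarith : 0 < p)
      rw [h]
      linarith
    · have hle : ‖(2⁻¹ : ℝ) • x + (2⁻¹ : ℝ) • y‖ ≤ 2⁻¹ * ‖x‖ + 2⁻¹ * ‖y‖ := by
        refine (norm_add_le _ _).trans_eq ?_
        simp [norm_smul]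
      have hlt := hconv.2 (norm_nonneg x) (norm_nonneg y) h
        (by norm_num : (0 : ℝ) < 2⁻¹) (by norm_num : (0 : ℝ) < 2⁻¹) (by norm_num)
      simp only [smul_eq_mul] at hlt
      have := Real.rpow_le_rpow (norm_nonneg _) hle hp0
      linarith
  have hpos : 0 < 2⁻¹ * (‖x‖ ^ p + ‖y‖ ^ p) := (by positivity : (0 : ℝ) ≤ _).trans_lt key
  have h := (ENNReal.ofReal_lt_ofReal_iff hpos).2 key
  rwa [ENNReal.ofReal_mul (by norm_num), ENNReal.ofReal_add (by positivity) (by positivity),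
    ← ENNReal.ofReal_rpow_of_nonneg (norm_nonneg _) hp0,
    ← ENNReal.ofReal_rpow_of_nonneg (norm_nonneg _) hp0,
    ← ENNReal.ofReal_rpow_of_nonneg (norm_nonneg _) hp0, ofReal_norm, ofReal_norm, ofReal_norm,
    ENNReal.ofReal_inv_of_pos (by norm_num), ENNReal.ofReal_ofNat] at h

/-- Two functions with values in a strictly convex space agree almost everywhere if passing to
their midpoint does not lower either of their finite `p`-th moments. -/
theorem ae_eq_of_lintegral_rpow_enorm_le_midpoint {α E : Type*} [MeasurableSpace α]
    {ν : Measure α} [NormedAddCommGroup E] [NormedSpace ℝ E] [StrictConvexSpace ℝ E]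
    {p : ℝ} (hp : 1 < p) {u v : α → E}
    (hu : AEStronglyMeasurable u ν) (hv : AEStronglyMeasurable v ν)
    (hu_fin : ∫⁻ a, ‖u a‖ₑ ^ p ∂ν ≠ ∞) (hv_fin : ∫⁻ a, ‖v a‖ₑ ^ p ∂ν ≠ ∞)
    (hu_le : ∫⁻ a, ‖u a‖ₑ ^ p ∂ν ≤ ∫⁻ a, ‖(2⁻¹ : ℝ) • (u a + v a)‖ₑ ^ p ∂ν)
    (hv_le : ∫⁻ a, ‖v a‖ₑ ^ p ∂ν ≤ ∫⁻ a, ‖(2⁻¹ : ℝ) • (u a + v a)‖ₑ ^ p ∂ν) :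
    u =ᵐ[ν] v := by
  have hle : ∀ a, ‖(2⁻¹ : ℝ) • (u a + v a)‖ₑ ^ p ≤ 2⁻¹ * (‖u a‖ₑ ^ p + ‖v a‖ₑ ^ p) := by
    intro a
    rcases eq_or_ne (u a) (v a) with h | h
    · rw [h, ← two_smul ℝ (v a), inv_smul_smul₀ two_ne_zero, ← two_mul, ← mul_assoc,
        ENNReal.inv_mul_cancel (by simp) (by simp), one_mul]
    · exact (enorm_midpoint_rpow_lt hp h).le
  have hmu : AEMeasurable (fun a ↦ ‖u a‖ₑ ^ p) ν := hu.enorm.pow_const p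
  have hmv : AEMeasurable (fun a ↦ ‖v a‖ₑ ^ p) ν := hv.enorm.pow_const p
  have hint : ∫⁻ a, 2⁻¹ * (‖u a‖ₑ ^ p + ‖v a‖ₑ ^ p) ∂ν
      = 2⁻¹ * (∫⁻ a, ‖u a‖ₑ ^ p ∂ν + ∫⁻ a, ‖v a‖ₑ ^ p ∂ν) := by
    rw [lintegral_const_mul' _ _ (by simp), lintegral_add_left' hmu]
  have hfin : ∫⁻ a, ‖(2⁻¹ : ℝ) • (u a + v a)‖ₑ ^ p ∂ν ≠ ∞ := by
    refine ne_top_of_le_ne_top ?_ (lintegral_mono hle)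
    rw [hint]
    exact ENNReal.mul_ne_top (by simp) (ENNReal.add_ne_top.2 ⟨hu_fin, hv_fin⟩)
  have hge : ∫⁻ a, 2⁻¹ * (‖u a‖ₑ ^ p + ‖v a‖ₑ ^ p) ∂ν
      ≤ ∫⁻ a, ‖(2⁻¹ : ℝ) • (u a + v a)‖ₑ ^ p ∂ν := by
    rw [hint]
    refine (mul_le_mul_right (add_le_add hu_le hv_le) _).trans_eq ?_
    rw [← two_mul, ← mul_assoc, ENNReal.inv_mul_cancel (by simp) (by simp), one_mul]
  have hae := ae_eq_of_ae_le_of_lintegral_le (ae_of_all _ hle) hfin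
    ((hmu.add hmv).const_mul _) hge
  filter_upwards [hae] with a ha
  by_contra hne
  exact (enorm_midpoint_rpow_lt hp hne).ne ha

theorem Lp_lintegral_rpow_enorm {α E : Type*} [MeasurableSpace α] {ν : Measure α}
    [NormedAddCommGroup E] {q : ℝ≥0∞} (hq0 : q ≠ 0) (hq : q ≠ ∞) (f : Lp E q ν) :
    ∫⁻ a, ‖f a‖ₑ ^ q.toReal ∂ν = ‖f‖ₑ ^ q.toReal := by
  rw [Lp.enorm_def, eLpNorm_eq_lintegral_rpow_enorm_toReal hq0 hq, ← ENNReal.rpow_mul,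
    one_div_mul_cancel (ENNReal.toReal_ne_zero.2 ⟨hq0, hq⟩), ENNReal.rpow_one]

/-- For `1 < q < ∞`, the space `L^q` of functions with values in a strictly convex space is
strictly convex. -/
theorem Lp_strictConvexSpace {α E : Type*} [MeasurableSpace α] {ν : Measure α}
    [NormedAddCommGroup E] [NormedSpace ℝ E] [StrictConvexSpace ℝ E]
    {q : ℝ≥0∞} [Fact (1 ≤ q)] (hq1 : 1 < q) (hq : q ≠ ∞) :
    StrictConvexSpace ℝ (Lp E q ν) := by
  have hq0 : q ≠ 0 := (zero_lt_one.trans hq1).ne'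
  refine StrictConvexSpace.of_norm_add_ne_two fun f g hf hg hfg hadd ↦ hfg ?_
  have hmid : ‖(2⁻¹ : ℝ) • (f + g)‖ = 1 := by
    rw [norm_smul, hadd]
    norm_num
  have hmoment : ∀ h : Lp E q ν, ‖h‖ = 1 → ∫⁻ a, ‖h a‖ₑ ^ q.toReal ∂ν = 1 := by
    intro h hh
    rw [Lp_lintegral_rpow_enorm hq0 hq, ← ofReal_norm, hh, ENNReal.ofReal_one, ENNReal.one_rpow]
  have hmid_int : ∫⁻ a, ‖(2⁻¹ : ℝ) • (f a + g a)‖ₑ ^ q.toReal ∂ν = 1 := by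
    rw [← hmoment _ hmid]
    refine lintegral_congr_ae ?_
    filter_upwards [Lp.coeFn_smul (2⁻¹ : ℝ) (f + g), Lp.coeFn_add f g] with a h₁ h₂
    rw [h₁, Pi.smul_apply, h₂, Pi.add_apply]
  have hq_real : 1 < q.toReal := by
    simpa using (ENNReal.toReal_lt_toReal ENNReal.one_ne_top hq).2 hq1
  refine Lp.ext (ae_eq_of_lintegral_rpow_enorm_le_midpoint hq_real
    (Lp.aestronglyMeasurable f) (Lp.aestronglyMeasurable g) ?_ ?_ ?_ ?_) <;>
  simp only [hmoment f hf, hmoment g hg, hmid_int, le_refl, ne_eq, ENNReal.one_ne_top,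
    not_false_eq_true]

/-- **Uniqueness of the `r`-barycenter in `L^q`.** Let `X = L^q(S, μ; ℝ^d)`
with `(S, μ)` σ-finite, `1 < q < ∞` and `1 < r < ∞`, and let `Y` be a strongly
measurable `X`-valued random variable with `E ‖Y‖ ^ r < ∞`. If `b₁` and `b₂`
both minimize the functional `Z ↦ E ‖Y - Z‖ ^ r` over `X`, then `b₁ = b₂`. -/
theorem unique_r_barycenter_Lq
    {S : Type*} [MeasurableSpace S] (μ : Measure S) [SigmaFinite μ]
    (q : ℝ≥0∞) [Fact (1 ≤ q)] (hq1 : 1 < q) (hq2 : q ≠ ∞)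
    (d : ℕ) (hd : 1 ≤ d)
    {Ω : Type*} [MeasurableSpace Ω] (P : Measure Ω) [IsProbabilityMeasure P]
    (r : ℝ) (hr : 1 < r)
    (Y : Ω → Lp (EuclideanSpace ℝ (Fin d)) q μ) (hY : StronglyMeasurable Y)
    (hmom : ∫⁻ ω, (‖Y ω‖₊ : ℝ≥0∞) ^ r ∂P < ∞)
    (b₁ b₂ : Lp (EuclideanSpace ℝ (Fin d)) q μ)
    (h₁ : ∀ Z : Lp (EuclideanSpace ℝ (Fin d)) q μ,
      ∫⁻ ω, (‖Y ω - b₁‖₊ : ℝ≥0∞) ^ r ∂P ≤ ∫⁻ ω, (‖Y ω - Z‖₊ : ℝ≥0∞) ^ r ∂P)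
    (h₂ : ∀ Z : Lp (EuclideanSpace ℝ (Fin d)) q μ,
      ∫⁻ ω, (‖Y ω - b₂‖₊ : ℝ≥0∞) ^ r ∂P ≤ ∫⁻ ω, (‖Y ω - Z‖₊ : ℝ≥0∞) ^ r ∂P) :
    b₁ = b₂ := by
  have := Lp_strictConvexSpace (ν := μ) (E := EuclideanSpace ℝ (Fin d)) hq1 hq2
  have hmid : ∀ ω, (2⁻¹ : ℝ) • ((Y ω - b₁) + (Y ω - b₂)) = Y ω - (2⁻¹ : ℝ) • (b₁ + b₂) := by
    intro ω
    module
  have hfin : ∫⁻ ω, ‖Y ω - 0‖ₑ ^ r ∂P < ∞ := by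
    simpa only [sub_zero, enorm_eq_nnnorm] using hmom
  have hae : (fun ω ↦ Y ω - b₁) =ᵐ[P] fun ω ↦ Y ω - b₂ := by
    refine ae_eq_of_lintegral_rpow_enorm_le_midpoint hr
      (hY.sub stronglyMeasurable_const).aestronglyMeasurable
      (hY.sub stronglyMeasurable_const).aestronglyMeasurable
      ((h₁ 0).trans_lt hfin).ne ((h₂ 0).trans_lt hfin).ne ?_ ?_ <;>
    simp only [hmid]
    exacts [h₁ _, h₂ _]
  obtain ⟨ω, hω⟩ := hae.exists
  exact sub_right_injective hω
end

section
/- Strong convergence of r-barycenters (Cuesta–Matrán type): Let (S, Σ, μ) be a σ-finite measure space, 1 < q < ∞, d ≥ 1, X = L^q(S, μ; ℝ^d), and 1 < r < γ < ∞. Let (Y_N)_{N=1}^∞ and Y be strongly measurable X-valued random variables on a probability space (Ω, ℬ, 𝒫) such that Y_N → Y in probability and sup_N E[‖Y_N‖_X^γ] < ∞. Then each Y_N and Y admit unique r-barycenters E_r[Y_N], E_r[Y] ∈ X, and E_r[Y_N] → E_r[Y] strongly in the norm of X as N → ∞. -/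
open MeasureTheory Filter Topology
open scoped ENNReal NNReal

/-- `b` is an `r`-barycenter of the `X`-valued random variable `Y` (defined on
the probability space `(Ω, P)`): it minimizes `Z ↦ E ‖Y - Z‖ ^ r` over `X`. -/
def IsRBarycenter {X : Type*} [NormedAddCommGroup X]
    {Ω : Type*} [MeasurableSpace Ω] (P : Measure Ω)
    (r : ℝ) (Y : Ω → X) (b : X) : Prop :=
  ∀ Z : X, ∫⁻ ω, (‖Y ω - b‖₊ : ℝ≥0∞) ^ r ∂P ≤ ∫⁻ ω, (‖Y ω - Z‖₊ : ℝ≥0∞) ^ r ∂P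

/-- A quantitative form of uniform convexity in terms of the `p`-th power of the norm. Being linear
in the quantities involved, it is inherited by `L^p` spaces through integration. -/
def RpowUniformConvex (E : Type*) [NormedAddCommGroup E] (p : ℝ) : Prop :=
  ∀ ε : ℝ, 0 < ε → ∃ C : ℝ, 0 ≤ C ∧ ∀ x y : E,
    ‖x - y‖ ^ p ≤ ε * (‖x‖ ^ p + ‖y‖ ^ p) +
      C * ((‖x‖ ^ p + ‖y‖ ^ p) / 2 - (‖x + y‖ / 2) ^ p)

theorem exists_pos_add_rpow_le_half_one_add_rpow {p c : ℝ} (hp : 1 < p) (hc0 : 0 ≤ c)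
    (hc1 : c < 1) :
    ∃ m : ℝ, 0 < m ∧ ∀ t s : ℝ, 0 ≤ t → t ≤ 1 → 0 ≤ s → s ≤ (1 + t) / 2 → s ≤ c →
      m + s ^ p ≤ (1 + t ^ p) / 2 := by
  have hp0 : 0 < p := by linarith
  let h : ℝ → ℝ := fun t => (1 + t ^ p) / 2 - (min ((1 + t) / 2) c) ^ p
  have hcont : Continuous h := by
    have h1 : Continuous fun t : ℝ => t ^ p := Real.continuous_rpow_const hp0.le
    have h2 : Continuous fun t : ℝ => (min ((1 + t) / 2) c) ^ p :=
      h1.comp (by fun_prop)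
    exact ((continuous_const.add h1).div_const 2).sub h2
  obtain ⟨t₀, ht₀, hmin⟩ := (isCompact_Icc (a := (0 : ℝ)) (b := 1)).exists_isMinOn
    ⟨0, by simp⟩ hcont.continuousOn
  refine ⟨h t₀, ?_, fun t s ht0 ht1 hs hst hsc => ?_⟩
  · obtain ⟨h0, h1⟩ := ht₀
    rcases h1.eq_or_lt with rfl | h1
    · have : c ^ p < 1 := Real.rpow_lt_one hc0 hc1 hp0
      simp only [h, Real.one_rpow]
      rw [min_eq_right (by linarith)]
      linarith
    · have hconv := (strictConvexOn_rpow hp).2 (show (1 : ℝ) ∈ Set.Ici 0 by simp) h0 h1.ne'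
        (show (0 : ℝ) < 1 / 2 by norm_num) (show (0 : ℝ) < 1 / 2 by norm_num)
        (by norm_num)
      simp only [smul_eq_mul, Real.one_rpow] at hconv
      have hle : (min ((1 + t₀) / 2) c) ^ p ≤ ((1 + t₀) / 2) ^ p :=
        Real.rpow_le_rpow (le_min (by linarith) hc0) (min_le_left _ _) hp0.le
      have : (1 / 2 * 1 + 1 / 2 * t₀ : ℝ) = (1 + t₀) / 2 := by ring
      rw [this] at hconv
      simp only [h]
      linarith
  · have h1 : h t₀ ≤ h t := hmin ⟨ht0, ht1⟩
    have h2 : s ^ p ≤ (min ((1 + t) / 2) c) ^ p := Real.rpow_le_rpow hs (le_min hst hsc) hp0.le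
    simp only [h] at h1 ⊢
    linarith

theorem half_norm_add_rpow_le {E : Type*} [SeminormedAddCommGroup E] {p : ℝ} (hp : 1 ≤ p)
    (x y : E) : (‖x + y‖ / 2) ^ p ≤ (‖x‖ ^ p + ‖y‖ ^ p) / 2 := by
  have hconv := (convexOn_rpow hp).2 (norm_nonneg x) (norm_nonneg y)
    (show (0 : ℝ) ≤ 1 / 2 by norm_num) (show (0 : ℝ) ≤ 1 / 2 by norm_num) (by norm_num)
  simp only [smul_eq_mul] at hconv
  have : (‖x + y‖ / 2) ^ p ≤ (1 / 2 * ‖x‖ + 1 / 2 * ‖y‖) ^ p := by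
    have := norm_add_le x y
    gcongr
    linarith
  linarith

theorem rpowUniformConvex_of_uniformConvexSpace (E : Type*) [NormedAddCommGroup E]
    [NormedSpace ℝ E] [UniformConvexSpace E] {p : ℝ} (hp : 1 < p) : RpowUniformConvex E p := by
  have hp0 : 0 < p := by linarith
  intro ε hε
  obtain ⟨δ, hδ, hUC⟩ := exists_forall_closed_ball_dist_add_le_two_sub E
    (ε := ε ^ p⁻¹) (by positivity)
  obtain ⟨m, hm, hgain⟩ := exists_pos_add_rpow_le_half_one_add_rpow (p := p)
    (c := max 0 (1 - δ / 2)) hp (le_max_left _ _) (max_lt one_pos (by linarith))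
  refine ⟨2 ^ p / m, by positivity, ?_⟩
  have hunit : ∀ x y : E, ‖x‖ = 1 → ‖y‖ ≤ 1 → ‖x - y‖ ^ p ≤ ε * (‖x‖ ^ p + ‖y‖ ^ p) +
      2 ^ p / m * ((‖x‖ ^ p + ‖y‖ ^ p) / 2 - (‖x + y‖ / 2) ^ p) := by
    intro x y hx hy
    have hy0 : 0 ≤ ‖y‖ ^ p := by positivity
    have hg0 := half_norm_add_rpow_le hp.le x y
    by_cases hxy : ε ^ p⁻¹ ≤ ‖x - y‖
    · have h1 := hUC hx.le hy hxy
      have h2 : m + (‖x + y‖ / 2) ^ p ≤ (1 + ‖y‖ ^ p) / 2 := by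
        refine hgain _ _ (norm_nonneg y) hy (by positivity) ?_ (le_max_of_le_right (by linarith))
        have := norm_add_le x y
        linarith
      have h3 : ‖x - y‖ ^ p ≤ 2 ^ p := by
        gcongr
        have := norm_sub_le x y
        linarith
      rw [hx, Real.one_rpow]
      calc ‖x - y‖ ^ p ≤ 2 ^ p / m * m := by rwa [div_mul_cancel₀ _ hm.ne']
        _ ≤ 2 ^ p / m * ((1 + ‖y‖ ^ p) / 2 - (‖x + y‖ / 2) ^ p) := by
          gcongr
          linarith
        _ ≤ _ := le_add_of_nonneg_left (by positivity)
    · have h1 : ‖x - y‖ ^ p ≤ ε := by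
        rw [Real.le_rpow_inv_iff_of_pos (norm_nonneg _) hε.le hp0 |>.symm]
        exact (not_le.1 hxy).le
      have h2 : 0 ≤ 2 ^ p / m * ((‖x‖ ^ p + ‖y‖ ^ p) / 2 - (‖x + y‖ / 2) ^ p) :=
        mul_nonneg (by positivity) (by linarith)
      have h3 : ε ≤ ε * (‖x‖ ^ p + ‖y‖ ^ p) := by
        rw [hx, Real.one_rpow]
        nlinarith
      linarith
  have hwlog : ∀ x y : E, ‖y‖ ≤ ‖x‖ → ‖x - y‖ ^ p ≤ ε * (‖x‖ ^ p + ‖y‖ ^ p) +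
      2 ^ p / m * ((‖x‖ ^ p + ‖y‖ ^ p) / 2 - (‖x + y‖ / 2) ^ p) := by
    intro x y hyx
    rcases eq_or_ne x 0 with rfl | hx
    · have : y = 0 := by simpa using hyx
      subst this
      simp [Real.zero_rpow hp0.ne']
    · have hx0 : 0 < ‖x‖ := norm_pos_iff.2 hx
      have hn : ∀ z : E, ‖‖x‖⁻¹ • z‖ = ‖x‖⁻¹ * ‖z‖ := fun z => by
        rw [norm_smul_of_nonneg (by positivity)]
      have h := hunit (‖x‖⁻¹ • x) (‖x‖⁻¹ • y) (by rw [hn, inv_mul_cancel₀ hx0.ne'])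
        (by rw [hn, inv_mul_le_one₀ hx0]; exact hyx)
      rw [← smul_sub, ← smul_add, hn, hn, hn, hn, mul_div_assoc,
        Real.mul_rpow (by positivity) (by positivity), Real.mul_rpow (by positivity) (by positivity),
        Real.mul_rpow (by positivity) (by positivity),
        Real.mul_rpow (by positivity) (by positivity)] at h
      have hpos : 0 < (‖x‖⁻¹) ^ p := by positivity
      refine le_of_mul_le_mul_left (h.trans_eq ?_) hpos
      ring
  intro x y
  rcases le_total ‖y‖ ‖x‖ with h | h
  · exact hwlog x y h
  · rw [norm_sub_rev, add_comm (‖x‖ ^ p), add_comm x]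
    exact hwlog y x h

theorem RpowUniformConvex.uniformConvexSpace {E : Type*} [NormedAddCommGroup E] {p : ℝ}
    (hp : 1 ≤ p) (h : RpowUniformConvex E p) : UniformConvexSpace E := by
  have hp0 : 0 < p := by linarith
  refine ⟨fun ε hε => ?_⟩
  have hεp : 0 < ε ^ p := by positivity
  obtain ⟨C, hC, hle⟩ := h (ε ^ p / 4) (by positivity)
  have hη : 0 < ε ^ p / (2 * (C + 1)) := by positivity
  set c : ℝ := (max 0 (1 - ε ^ p / (2 * (C + 1)))) ^ p⁻¹ with hc
  have hc1 : c < 1 :=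
    Real.rpow_lt_one (le_max_left _ _) (max_lt one_pos (by linarith)) (by positivity)
  refine ⟨2 - 2 * c, by linarith, fun x hx y hy hxy => ?_⟩
  have h1 := hle x y
  have h2 : ε ^ p ≤ ‖x - y‖ ^ p := by gcongr
  have hg := half_norm_add_rpow_le hp x y
  rw [hx, hy, Real.one_rpow] at h1 hg
  have h3 : ε ^ p / (2 * (C + 1)) ≤ 1 - (‖x + y‖ / 2) ^ p := by
    rw [div_le_iff₀ (by positivity)]
    nlinarith
  have h4 : ‖x + y‖ / 2 ≤ c := by
    rw [hc, Real.le_rpow_inv_iff_of_pos (by positivity) (le_max_left _ _) hp0]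
    exact le_max_of_le_right (by linarith)
  linarith

theorem MeasureTheory.Lp.norm_rpow_eq_integral_s9 {α E : Type*} [MeasurableSpace α] {μ : Measure α}
    [NormedAddCommGroup E] {p : ℝ≥0∞} (hp0 : p ≠ 0) (hp : p ≠ ∞) (f : Lp E p μ) :
    ‖f‖ ^ p.toReal = ∫ a, ‖f a‖ ^ p.toReal ∂μ := by
  have hpos : 0 < p.toReal := ENNReal.toReal_pos hp0 hp
  have hint : 0 ≤ ∫ a, ‖f a‖ ^ p.toReal ∂μ := integral_nonneg fun a => by positivity
  rw [Lp.norm_def, (Lp.memLp f).eLpNorm_eq_integral_rpow_norm hp0 hp,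
    ENNReal.toReal_ofReal (by positivity), Real.rpow_inv_rpow hint hpos.ne']

theorem RpowUniformConvex.lp {α E : Type*} [MeasurableSpace α] {μ : Measure α}
    [NormedAddCommGroup E] {p : ℝ≥0∞} [Fact (1 ≤ p)] (hp : p ≠ ∞)
    (h : RpowUniformConvex E p.toReal) : RpowUniformConvex (Lp E p μ) p.toReal := by
  have hp0 : p ≠ 0 := (zero_lt_one.trans_le Fact.out).ne'
  intro ε hε
  obtain ⟨C, hC, hle⟩ := h ε hε
  refine ⟨C, hC, fun f g => ?_⟩
  have hint : ∀ f : Lp E p μ, Integrable (fun a => ‖f a‖ ^ p.toReal) μ := fun f =>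
    (Lp.memLp f).integrable_norm_rpow hp0 hp
  have hsum : Integrable (fun a => ‖f a‖ ^ p.toReal + ‖g a‖ ^ p.toReal) μ := (hint f).add (hint g)
  have hmid : Integrable (fun a => ‖(f + g) a‖ ^ p.toReal / 2 ^ p.toReal) μ :=
    (hint (f + g)).div_const _
  have hgap : Integrable (fun a => (‖f a‖ ^ p.toReal + ‖g a‖ ^ p.toReal) / 2 -
      ‖(f + g) a‖ ^ p.toReal / 2 ^ p.toReal) μ := (hsum.div_const 2).sub hmid
  rw [Real.div_rpow (by positivity) (by positivity)]
  simp only [Lp.norm_rpow_eq_integral_s9 hp0 hp]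
  rw [← integral_add (hint f) (hint g), ← integral_const_mul, ← integral_div, ← integral_div,
    ← integral_sub (hsum.div_const 2) hmid, ← integral_const_mul,
    ← integral_add (hsum.const_mul ε) (hgap.const_mul C)]
  refine integral_mono_ae (hint (f - g)) ((hsum.const_mul ε).add (hgap.const_mul C)) ?_
  filter_upwards [Lp.coeFn_sub f g, Lp.coeFn_add f g] with a hs ha
  have := hle (f a) (g a)
  rw [Real.div_rpow (by positivity) (by positivity)] at this
  simpa only [hs, ha, Pi.add_apply, Pi.sub_apply] using this

theorem uniformConvexSpace_lp {α E : Type*} [MeasurableSpace α] (μ : Measure α)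
    [NormedAddCommGroup E] [NormedSpace ℝ E] [UniformConvexSpace E] {p : ℝ≥0∞} [Fact (1 ≤ p)]
    (hp1 : 1 < p) (hp : p ≠ ∞) : UniformConvexSpace (Lp E p μ) := by
  have hp' : 1 < p.toReal := by
    rw [← ENNReal.toReal_one]
    exact (ENNReal.toReal_lt_toReal ENNReal.one_ne_top hp).2 hp1
  exact ((rpowUniformConvex_of_uniformConvexSpace E hp').lp hp).uniformConvexSpace hp'.le

section Projection

variable {X W : Type*} [NormedAddCommGroup X] [NormedSpace ℝ X] [NormedAddCommGroup W]
  [NormedSpace ℝ W]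

theorem norm_sub_eq_iInf_of_forall_le {J : X →ₗᵢ[ℝ] W} {w : W} {b : X}
    (hb : ∀ z, ‖w - J b‖ ≤ ‖w - J z‖) : ‖w - J b‖ = ⨅ z, ‖w - J z‖ :=
  le_antisymm (le_ciInf hb) (ciInf_le ⟨0, by rintro _ ⟨z, rfl⟩; exact norm_nonneg _⟩ b)

variable [UniformConvexSpace W]

theorem exists_pos_norm_sub_le_of_almost_nearest (J : X →ₗᵢ[ℝ] W) (w : W) {ε : ℝ} (hε : 0 < ε) :
    ∃ η : ℝ, 0 < η ∧ ∀ u v : X, ‖w - J u‖ ≤ (⨅ z, ‖w - J z‖) + η →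
      ‖w - J v‖ ≤ (⨅ z, ‖w - J z‖) + η → ‖u - v‖ ≤ ε := by
  set D : ℝ := ⨅ z, ‖w - J z‖ with hD
  have hD0 : 0 ≤ D := Real.iInf_nonneg fun _ => norm_nonneg _
  have hDle : ∀ z, D ≤ ‖w - J z‖ := fun z =>
    ciInf_le ⟨0, by rintro _ ⟨z, rfl⟩; exact norm_nonneg _⟩ z
  have huc : RpowUniformConvex W 2 := rpowUniformConvex_of_uniformConvexSpace W one_lt_two
  obtain ⟨C, hC, hle⟩ := huc (ε ^ 2 / (4 * (D + 1) ^ 2)) (by positivity)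
  refine ⟨min 1 (ε ^ 2 / (2 * (2 * D + 1) * (C + 1))), lt_min one_pos (by positivity),
    fun u v hu hv => ?_⟩
  set η := min 1 (ε ^ 2 / (2 * (2 * D + 1) * (C + 1))) with hη
  have hη0 : 0 < η := lt_min one_pos (by positivity)
  have hη1 : η ≤ 1 := min_le_left _ _
  have hηC : (2 * D + 1) * (C + 1) * η ≤ ε ^ 2 / 2 := by
    calc (2 * D + 1) * (C + 1) * η
        ≤ (2 * D + 1) * (C + 1) * (ε ^ 2 / (2 * (2 * D + 1) * (C + 1))) := by
          gcongr
          exact min_le_right _ _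
      _ = ε ^ 2 / 2 := by field_simp
  have h := hle (w - J u) (w - J v)
  simp only [Real.rpow_two] at h
  have hdiff : ‖(w - J u) - (w - J v)‖ = ‖u - v‖ := by
    rw [sub_sub_sub_cancel_left, ← map_sub, J.norm_map, norm_sub_rev]
  have hmid : D ≤ ‖(w - J u) + (w - J v)‖ / 2 := by
    have h2 : (w - J u) + (w - J v) = (2 : ℝ) • (w - J ((2⁻¹ : ℝ) • (u + v))) := by
      rw [map_smul, map_add, smul_sub, smul_inv_smul₀ two_ne_zero, two_smul]
      abel
    have := hDle ((2⁻¹ : ℝ) • (u + v))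
    rw [h2, norm_smul, Real.norm_two]
    linarith
  rw [hdiff] at h
  have hu2 : ‖w - J u‖ ^ 2 ≤ (D + η) ^ 2 := by gcongr
  have hv2 : ‖w - J v‖ ^ 2 ≤ (D + η) ^ 2 := by gcongr
  have hm2 : D ^ 2 ≤ (‖(w - J u) + (w - J v)‖ / 2) ^ 2 := by gcongr
  have hb : (D + η) ^ 2 ≤ (D + 1) ^ 2 := by gcongr
  have hg : (D + η) ^ 2 - D ^ 2 ≤ (2 * D + 1) * η := by nlinarith
  have h1 : ε ^ 2 / (4 * (D + 1) ^ 2) * (‖w - J u‖ ^ 2 + ‖w - J v‖ ^ 2) ≤ ε ^ 2 / 2 := by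
    calc _ ≤ ε ^ 2 / (4 * (D + 1) ^ 2) * (2 * (D + 1) ^ 2) := by
          gcongr
          linarith
      _ = ε ^ 2 / 2 := by field_simp; norm_num
  have h2 : C * ((‖w - J u‖ ^ 2 + ‖w - J v‖ ^ 2) / 2 - (‖(w - J u) + (w - J v)‖ / 2) ^ 2) ≤
      C * ((2 * D + 1) * η) := by
    gcongr
    linarith
  have h3 : C * ((2 * D + 1) * η) ≤ (2 * D + 1) * (C + 1) * η := by
    have : 0 ≤ (2 * D + 1) * η := by positivity
    linarith
  exact le_of_sq_le_sq (by linarith) hε.le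

theorem eq_of_nearest {J : X →ₗᵢ[ℝ] W} {w : W} {b b' : X} (hb : ∀ z, ‖w - J b‖ ≤ ‖w - J z‖)
    (hb' : ∀ z, ‖w - J b'‖ ≤ ‖w - J z‖) : b' = b := by
  rw [← sub_eq_zero, ← norm_le_zero_iff]
  refine le_of_forall_pos_le_add fun ε hε => ?_
  obtain ⟨η, hη, h⟩ := exists_pos_norm_sub_le_of_almost_nearest J w hε
  rw [zero_add]
  refine h _ _ ?_ ?_
  · rw [norm_sub_eq_iInf_of_forall_le hb']; linarith
  · rw [norm_sub_eq_iInf_of_forall_le hb]; linarith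

theorem exists_nearest [CompleteSpace X] (J : X →ₗᵢ[ℝ] W) (w : W) :
    ∃ b, ∀ z, ‖w - J b‖ ≤ ‖w - J z‖ := by
  have hex : ∀ n : ℕ, ∃ u : X, ‖w - J u‖ < (⨅ z, ‖w - J z‖) + 1 / ((n : ℝ) + 1) := fun n =>
    exists_lt_of_ciInf_lt (lt_add_of_pos_right _ Nat.one_div_pos_of_nat)
  choose u hu using hex
  have hcau : CauchySeq u := by
    refine Metric.cauchySeq_iff'.2 fun ε hε => ?_
    obtain ⟨η, hη, h⟩ := exists_pos_norm_sub_le_of_almost_nearest J w (half_pos hε)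
    obtain ⟨N, hN⟩ := exists_nat_one_div_lt hη
    have hle : ∀ n ≥ N, ‖w - J (u n)‖ ≤ (⨅ z, ‖w - J z‖) + η := fun n hn => by
      have := Nat.one_div_le_one_div (α := ℝ) hn
      linarith [hu n]
    refine ⟨N, fun n hn => ?_⟩
    rw [dist_eq_norm]
    linarith [h _ _ (hle n hn) (hle N le_rfl)]
  obtain ⟨b, hb⟩ := cauchySeq_tendsto_of_complete hcau
  refine ⟨b, fun z => ?_⟩
  have h1 : Tendsto (fun n => ‖w - J (u n)‖) atTop (𝓝 ‖w - J b‖) :=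
    (tendsto_const_nhds.sub ((J.continuous.tendsto b).comp hb)).norm
  have h2 : Tendsto (fun n : ℕ => (⨅ z, ‖w - J z‖) + 1 / ((n : ℝ) + 1)) atTop
      (𝓝 ((⨅ z, ‖w - J z‖) + 0)) :=
    tendsto_const_nhds.add tendsto_one_div_add_atTop_nhds_zero_nat
  have h3 := le_of_tendsto_of_tendsto' h1 h2 fun n => (hu n).le
  rw [add_zero] at h3
  exact h3.trans (ciInf_le ⟨0, by rintro _ ⟨z, rfl⟩; exact norm_nonneg _⟩ z)

theorem tendsto_nearest {ι : Type*} {l : Filter ι} {J : X →ₗᵢ[ℝ] W} {w : ι → W} {w₀ : W}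
    {b : ι → X} {b₀ : X} (hw : Tendsto w l (𝓝 w₀))
    (hb : ∀ i z, ‖w i - J (b i)‖ ≤ ‖w i - J z‖) (hb₀ : ∀ z, ‖w₀ - J b₀‖ ≤ ‖w₀ - J z‖) :
    Tendsto b l (𝓝 b₀) := by
  refine Metric.tendsto_nhds.2 fun ε hε => ?_
  obtain ⟨η, hη, h⟩ := exists_pos_norm_sub_le_of_almost_nearest J w₀ (half_pos hε)
  filter_upwards [Metric.tendsto_nhds.1 hw (η / 2) (half_pos hη)] with i hi
  rw [dist_eq_norm] at hi ⊢
  have heq := norm_sub_eq_iInf_of_forall_le hb₀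
  have h1 : ‖w₀ - J (b i)‖ ≤ ‖w₀ - w i‖ + ‖w i - J (b i)‖ := norm_sub_le_norm_sub_add_norm_sub _ _ _
  have h2 : ‖w i - J b₀‖ ≤ ‖w i - w₀‖ + ‖w₀ - J b₀‖ := norm_sub_le_norm_sub_add_norm_sub _ _ _
  rw [norm_sub_rev w₀ (w i)] at h1
  have := h (b i) b₀ (by linarith [hb i b₀]) (by linarith)
  linarith

end Projection

section Integrability

variable {Ω E : Type*} [MeasurableSpace Ω] {P : Measure Ω} [NormedAddCommGroup E]

theorem unifIntegrable_of_eLpNorm_le {ι : Type*} {p s : ℝ≥0∞} (hp0 : p ≠ 0) (hps : p < s)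
    {f : ι → Ω → E} (hf : ∀ i, AEStronglyMeasurable (f i) P) {C : ℝ≥0∞} (hC : C ≠ ∞)
    (hle : ∀ i, eLpNorm (f i) s P ≤ C) : UnifIntegrable f p P := by
  intro ε hε
  set t : ℝ := 1 / p.toReal - 1 / s.toReal with ht
  have hp : p ≠ ∞ := hps.ne_top
  have hppos : 0 < p.toReal := ENNReal.toReal_pos hp0 hp
  have ht0 : 0 < t := by
    rcases eq_or_ne s ∞ with rfl | hs
    · simpa [ht] using hppos
    · exact sub_pos.2 (one_div_lt_one_div_of_lt hppos ((ENNReal.toReal_lt_toReal hp hs).2 hps))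
  have htend : Tendsto (fun x : ℝ≥0∞ => C * x ^ t) (𝓝 0) (𝓝 0) := by
    have h1 : Tendsto (fun x : ℝ≥0∞ => x ^ t) (𝓝 0) (𝓝 0) := by
      simpa [ENNReal.zero_rpow_of_pos ht0] using
        (ENNReal.continuous_rpow_const (y := t)).tendsto 0
    simpa using ENNReal.Tendsto.const_mul h1 (Or.inr hC)
  obtain ⟨δ, hδ, hsub⟩ := ENNReal.nhds_zero_basis_Iic.eventually_iff.1
    (htend.eventually (Iic_mem_nhds (ENNReal.ofReal_pos.2 hε)))
  have hmin : min δ 1 ≠ ∞ := ((min_le_right _ _).trans_lt ENNReal.one_lt_top).ne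
  refine ⟨(min δ 1).toReal, ENNReal.toReal_pos (lt_min hδ one_pos).ne' hmin,
    fun i A hA hPA => ?_⟩
  rw [ENNReal.ofReal_toReal hmin] at hPA
  rw [eLpNorm_indicator_eq_eLpNorm_restrict hA]
  calc eLpNorm (f i) p (P.restrict A)
      ≤ eLpNorm (f i) s (P.restrict A) * (P.restrict A) Set.univ ^ t :=
        eLpNorm_le_eLpNorm_mul_rpow_measure_univ hps.le (hf i).restrict
    _ ≤ C * P A ^ t := by
        rw [Measure.restrict_apply_univ]
        gcongr
        exact (eLpNorm_mono_measure _ Measure.restrict_le_self).trans (hle i)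
    _ ≤ ENNReal.ofReal ε := hsub (hPA.trans (min_le_left _ _))

variable [IsProbabilityMeasure P]

theorem uniformIntegrable_of_eLpNorm_le {ι : Type*} {p s : ℝ≥0∞} (hp0 : p ≠ 0) (hps : p < s)
    {f : ι → Ω → E} (hf : ∀ i, AEStronglyMeasurable (f i) P) {C : ℝ≥0∞} (hC : C ≠ ∞)
    (hle : ∀ i, eLpNorm (f i) s P ≤ C) : UniformIntegrable f p P := by
  refine ⟨hf, unifIntegrable_of_eLpNorm_le hp0 hps hf hC hle, C.toNNReal, fun i => ?_⟩
  rw [ENNReal.coe_toNNReal hC]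
  exact (eLpNorm_le_eLpNorm_of_exponent_le hps.le (hf i)).trans (hle i)

variable [NormedSpace ℝ E]

/-- The isometric embedding of `E` into `L^p` as constant functions on a probability space. -/
noncomputable def constLpLinearIsometry (E : Type*) [NormedAddCommGroup E] [NormedSpace ℝ E]
    (p : ℝ≥0∞) [Fact (1 ≤ p)] (P : Measure Ω) [IsProbabilityMeasure P] : E →ₗᵢ[ℝ] Lp E p P where
  toLinearMap := Lp.constₗ p P ℝ
  norm_map' c := by
    have : p ≠ 0 := (zero_lt_one.trans_le Fact.out).ne'
    simp [Lp.norm_const, this]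

theorem isRBarycenter_iff_nearest {r : ℝ} (hr : 0 < r) [Fact (1 ≤ ENNReal.ofReal r)]
    {Y : Ω → E} (hY : MemLp Y (ENNReal.ofReal r) P) (b : E) :
    IsRBarycenter P r Y b ↔
      ∀ z, ‖hY.toLp Y - constLpLinearIsometry E (ENNReal.ofReal r) P b‖ ≤
        ‖hY.toLp Y - constLpLinearIsometry E (ENNReal.ofReal r) P z‖ := by
  have hr0 : ENNReal.ofReal r ≠ 0 := (ENNReal.ofReal_pos.2 hr).ne'
  have key : ∀ z, ∫⁻ ω, (‖Y ω - z‖₊ : ℝ≥0∞) ^ r ∂P =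
      ‖hY.toLp Y - constLpLinearIsometry E (ENNReal.ofReal r) P z‖ₑ ^ r := fun z => by
    have h1 : hY.toLp Y - constLpLinearIsometry E (ENNReal.ofReal r) P z =
        (hY.sub (memLp_const z)).toLp (Y - fun _ => z) := rfl
    rw [h1, Lp.enorm_toLp, eLpNorm_eq_lintegral_rpow_enorm_toReal hr0 ENNReal.ofReal_ne_top,
      ENNReal.toReal_ofReal hr.le, ← ENNReal.rpow_mul, one_div_mul_cancel hr.ne', ENNReal.rpow_one]
    rfl
  refine forall_congr' fun z => ?_
  rw [key, key, ENNReal.rpow_le_rpow_iff hr, enorm_le_iff_norm_le]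

end Integrability

/-- **Strong convergence of `r`-barycenters (Cuesta–Matrán type).** Let
`X = L^q(S, μ; ℝ^d)` with `(S, μ)` σ-finite, `1 < q < ∞`, `1 < r < γ < ∞`.
If the `X`-valued random variables `Y N → Y` in probability and the `γ`-th
moments of the `Y N` are uniformly bounded, then each `Y N` and `Y` admit
unique `r`-barycenters `b N` and `blim`, and `b N → blim` strongly in `X`. -/
theorem r_barycenters_converge
    {S : Type*} [MeasurableSpace S] (μ : Measure S) [SigmaFinite μ]
    (q : ℝ≥0∞) [Fact (1 ≤ q)] (hq1 : 1 < q) (hq2 : q ≠ ∞)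
    (d : ℕ) (hd : 1 ≤ d)
    {Ω : Type*} [MeasurableSpace Ω] (P : Measure Ω) [IsProbabilityMeasure P]
    (r γ : ℝ) (hr : 1 < r) (hrγ : r < γ)
    (Y : ℕ → Ω → Lp (EuclideanSpace ℝ (Fin d)) q μ)
    (Ylim : Ω → Lp (EuclideanSpace ℝ (Fin d)) q μ)
    (hY : ∀ N, StronglyMeasurable (Y N)) (hYlim : StronglyMeasurable Ylim)
    (hprob : ∀ ε : ℝ, 0 < ε →
      Tendsto (fun N => P {ω | ε < ‖Y N ω - Ylim ω‖}) atTop (𝓝 0))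
    (hmom : ∃ C : ℝ≥0∞, C < ∞ ∧
      ∀ N, ∫⁻ ω, (‖Y N ω‖₊ : ℝ≥0∞) ^ γ ∂P ≤ C) :
    ∃ (b : ℕ → Lp (EuclideanSpace ℝ (Fin d)) q μ)
      (blim : Lp (EuclideanSpace ℝ (Fin d)) q μ),
      (∀ N, IsRBarycenter P r (Y N) (b N)) ∧
      (∀ N b', IsRBarycenter P r (Y N) b' → b' = b N) ∧
      IsRBarycenter P r Ylim blim ∧
      (∀ b', IsRBarycenter P r Ylim b' → b' = blim) ∧
      Tendsto b atTop (𝓝 blim) := by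
  have hr0 : 0 < r := one_pos.trans hr
  have hγ0 : 0 < γ := hr0.trans hrγ
  have hr1 : 1 < ENNReal.ofReal r := by simpa using hr
  have hrγ' : ENNReal.ofReal r < ENNReal.ofReal γ := (ENNReal.ofReal_lt_ofReal_iff hγ0).2 hrγ
  have : Fact (1 ≤ ENNReal.ofReal r) := ⟨hr1.le⟩
  have := uniformConvexSpace_lp (E := EuclideanSpace ℝ (Fin d)) μ hq1 hq2
  have := uniformConvexSpace_lp (E := Lp (EuclideanSpace ℝ (Fin d)) q μ) P hr1
    ENNReal.ofReal_ne_top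
  obtain ⟨C, hC, hmom⟩ := hmom
  have hbound : ∀ N, eLpNorm (Y N) (ENNReal.ofReal γ) P ≤ C ^ (1 / γ) := fun N => by
    rw [eLpNorm_eq_lintegral_rpow_enorm_toReal (ENNReal.ofReal_pos.2 hγ0).ne'
      ENNReal.ofReal_ne_top, ENNReal.toReal_ofReal hγ0.le]
    gcongr
    exact hmom N
  have hUI : UniformIntegrable Y (ENNReal.ofReal r) P :=
    uniformIntegrable_of_eLpNorm_le (zero_lt_one.trans hr1).ne' hrγ'
      (fun N => (hY N).aestronglyMeasurable) (ENNReal.rpow_lt_top_of_nonneg (by positivity) hC.ne).ne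
      hbound
  have hconv : TendstoInMeasure P Y atTop Ylim := by
    rw [tendstoInMeasure_iff_norm]
    intro ε hε
    refine tendsto_of_tendsto_of_tendsto_of_le_of_le tendsto_const_nhds (hprob (ε / 2) (half_pos hε))
      (fun _ => zero_le) fun N => measure_mono fun ω hω => ?_
    exact (half_lt_self hε).trans_le hω
  have hmem : ∀ N, MemLp (Y N) (ENNReal.ofReal r) P := hUI.memLp
  have hmemlim : MemLp Ylim (ENNReal.ofReal r) P := hUI.memLp_of_tendstoInMeasure hconv
  have hLp : Tendsto (fun N => (hmem N).toLp (Y N)) atTop (𝓝 (hmemlim.toLp Ylim)) := by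
    rw [Lp.tendsto_Lp_iff_tendsto_eLpNorm'']
    exact tendsto_Lp_finite_of_tendstoInMeasure hr1.le ENNReal.ofReal_ne_top
      (fun N => (hY N).aestronglyMeasurable) hmemlim hUI.2.1 hconv
  choose b hb using fun N => exists_nearest (constLpLinearIsometry _ _ P) ((hmem N).toLp (Y N))
  obtain ⟨blim, hblim⟩ := exists_nearest (constLpLinearIsometry _ _ P) (hmemlim.toLp Ylim)
  exact ⟨b, blim, fun N => (isRBarycenter_iff_nearest hr0 (hmem N) _).2 (hb N),
    fun N b' hb' => eq_of_nearest (hb N) ((isRBarycenter_iff_nearest hr0 (hmem N) _).1 hb'),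
    (isRBarycenter_iff_nearest hr0 hmemlim _).2 hblim,
    fun b' hb' => eq_of_nearest hblim ((isRBarycenter_iff_nearest hr0 hmemlim _).1 hb'),
    tendsto_nearest hLp hb hblim⟩
end
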